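/- Let K be a field and n ≥ 1, and let f_i : V_i → V_{i+1} (for i = 1,…,n−1) be K-linear maps between K-vector spaces (a representation of the linearly oriented quiver of type A_n). Then there exist bases B_i of V_i for each i such that every f_i sends each element of B_i either to 0 or to an element of B_{i+1}, and f_i is injective on the set of elements of B_i not sent to 0. In particular, every representation of the linearly oriented A_n quiver is a direct sum of thin representations. -/

import Mathlib

open Submodule in
/-- An initial segment of an increasing sequence of subspaces admits an adapted basis. -/
theorem exists_linearIndepOn_adapted {K V : Type*} [Field K] [AddCommGroup V] [Module K V]
    {W : ℕ → Submodule K V} (hW : Monotone W) (k : ℕ) :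
    ∃ B : Set V, B ⊆ W k ∧ LinearIndepOn K id B ∧ ∀ j ≤ k, W j ≤ span K (B ∩ W j) := by
  induction k with
  | zero =>
    obtain ⟨B, hB, -, hspan, hli⟩ := exists_linearIndepOn_id_extension
      (linearIndepOn_empty K (id : V → V)) (Set.empty_subset (W 0 : Set V))
    refine ⟨B, hB, hli, fun j hj ↦ ?_⟩
    obtain rfl : j = 0 := by omega
    rwa [Set.inter_eq_left.2 hB]
  | succ k ih =>
    obtain ⟨C, hC, hCli, hCspan⟩ := ih
    obtain ⟨B, hB, hCB, hspan, hli⟩ := exists_linearIndepOn_id_extension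
      hCli (hC.trans (hW k.le_succ))
    refine ⟨B, hB, hli, fun j hj ↦ ?_⟩
    rcases hj.lt_or_eq with hj | rfl
    · exact (hCspan j (by omega)).trans (span_mono (Set.inter_subset_inter_left _ hCB))
    · rwa [Set.inter_eq_left.2 hB]

open Submodule in
/-- A basis of the target adapted to the image of a filtration lifts to a basis of the source
adapted to the filtration. -/
theorem exists_linearIndepOn_adapted_lift {K V V' : Type*} [Field K] [AddCommGroup V]
    [Module K V] [AddCommGroup V'] [Module K V'] (f : V →ₗ[K] V')
    {W : ℕ → Submodule K V} (hW : Monotone W) {k : ℕ} (hk : W k = ⊤)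
    {B' : Set V'} (hli : LinearIndepOn K id B')
    (hB' : ∀ j ≤ k, (W j).map f ≤ span K (B' ∩ (W j).map f)) :
    ∃ B : Set V, LinearIndepOn K id B ∧ (∀ j ≤ k, W j ≤ span K (B ∩ W j)) ∧
      (∀ b ∈ B, f b = 0 ∨ f b ∈ B') ∧ Set.InjOn f {b ∈ B | f b ≠ 0} := by
  obtain ⟨C, hC, hCli, hCspan⟩ := exists_linearIndepOn_adapted
    (W := fun j ↦ f.ker ⊓ W j) (fun i j h ↦ inf_le_inf_left _ (hW h)) k
  have hCker : C ⊆ f.ker := fun x hx ↦ (hC hx).1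
  have lift : ∀ b : (B' ∩ f.range : Set V'),
      ∃ x, f x = b ∧ ∀ j ≤ k, (b : V') ∈ (W j).map f → x ∈ W j := by
    classical
    rintro ⟨b, -, y, rfl⟩
    have hex : ∃ j, f y ∈ (W j).map f := ⟨k, y, by simp [hk], rfl⟩
    obtain ⟨x, hx, hxy⟩ := Nat.find_spec hex
    exact ⟨x, hxy, fun j _ hj ↦ hW (Nat.find_min' hex hj) hx⟩
  choose g hfg hg using lift
  have hcomp : LinearIndependent K (f ∘ g) := by
    rw [show f ∘ g = Subtype.val from funext hfg]
    exact hli.mono Set.inter_subset_left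
  refine ⟨C ∪ Set.range g, hCli.id_union hcomp.of_comp.linearIndepOn_id ?_, ?_, ?_, ?_⟩
  · exact (Submodule.range_ker_disjoint hcomp).symm.mono_left (span_le.2 hCker)
  · intro j hj w hw
    have hle : (W j).map f ≤ (span K ((C ∪ Set.range g) ∩ W j)).map f := by
      refine (hB' j hj).trans (span_le.2 ?_)
      rintro b ⟨hb, hbj⟩
      have hb' : b ∈ B' ∩ f.range := ⟨hb, f.map_le_range hbj⟩
      exact ⟨g ⟨b, hb'⟩, subset_span ⟨.inr ⟨_, rfl⟩, hg ⟨b, hb'⟩ j hj hbj⟩, hfg ⟨b, hb'⟩⟩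
    obtain ⟨u, hu, huw⟩ := hle ⟨w, hw, rfl⟩
    have huW : u ∈ W j := span_le.2 Set.inter_subset_right hu
    have hker : w - u ∈ f.ker ⊓ W j := ⟨by simp [huw], sub_mem hw huW⟩
    have hsub : C ∩ (f.ker ⊓ W j : Submodule K V) ⊆ (C ∪ Set.range g) ∩ W j :=
      fun x hx ↦ ⟨.inl hx.1, hx.2.2⟩
    simpa using add_mem (span_mono hsub (hCspan j hj hker)) hu
  · rintro b (hb | ⟨c, rfl⟩)
    · exact .inl (hCker hb)
    · exact .inr (hfg c ▸ c.2.1)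
  · rintro x ⟨hx | ⟨c, rfl⟩, hx0⟩ y ⟨hy | ⟨d, rfl⟩, hy0⟩ hxy
    · exact absurd (hCker hx) hx0
    · exact absurd (hCker hx) hx0
    · exact absurd (hCker hy) hy0
    · rw [hfg, hfg] at hxy
      rw [Subtype.ext hxy]

open Submodule in
/-- The bases of a representation of a linearly oriented `A_n` quiver can be chosen so that the
first one is adapted to a given filtration. -/
theorem exists_adapted_bases_linear_An_rep {K : Type*} [Field K] (n : ℕ)
    (V : Fin (n + 1) → Type*) [∀ i, AddCommGroup (V i)] [∀ i, Module K (V i)]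
    (f : ∀ i : Fin n, V i.castSucc →ₗ[K] V i.succ)
    {W : ℕ → Submodule K (V 0)} (hW : Monotone W) {k : ℕ} (hk : W k = ⊤) :
    ∃ B : ∀ i, Set (V i),
      (∀ i, LinearIndepOn K id (B i) ∧ span K (B i) = ⊤) ∧
      (∀ i : Fin n,
        (∀ b ∈ B i.castSucc, f i b = 0 ∨ f i b ∈ B i.succ) ∧
        Set.InjOn (f i) {b ∈ B i.castSucc | f i b ≠ 0}) ∧
      ∀ j ≤ k, W j ≤ span K (B 0 ∩ W j) := by
  induction n generalizing k with
  | zero =>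
    obtain ⟨B, -, hli, hB⟩ := exists_linearIndepOn_adapted hW k
    have hspan : span K B = ⊤ := by simpa [hk] using hB k le_rfl
    refine ⟨Fin.cons B fun i ↦ i.elim0, fun i ↦ ?_, fun i ↦ i.elim0, hB⟩
    obtain rfl := Fin.fin_one_eq_zero i
    exact ⟨hli, hspan⟩
  | succ n ih =>
    let f₀ : V 0 →ₗ[K] V (Fin.succ 0) := f 0
    let W' : ℕ → Submodule K (V (Fin.succ 0)) := fun j ↦ if j ≤ k then (W j).map f₀ else ⊤
    have hW' : Monotone W' := by
      intro i j hij
      by_cases hj : j ≤ k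
      · simpa only [W', if_pos hj, if_pos (hij.trans hj)] using map_mono (hW hij)
      · exact le_top.trans_eq (if_neg hj).symm
    obtain ⟨B', hB', hf, hadapt⟩ := ih (fun i ↦ V i.succ) (fun i ↦ f i.succ) (W := W') hW'
      (k := k + 1) (if_neg (by omega))
    obtain ⟨B, hli, hB, hmap, hinj⟩ := exists_linearIndepOn_adapted_lift f₀ hW hk (hB' 0).1
      fun j hj ↦ by simpa only [W', if_pos hj] using hadapt j (by omega)
    have hspan : span K B = ⊤ := by simpa [hk] using hB k le_rfl
    refine ⟨Fin.cons B B', Fin.cases ⟨hli, hspan⟩ hB', Fin.cases ⟨hmap, hinj⟩ hf, hB⟩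

/-- Every representation of the linearly oriented quiver of type `A_n` (here with
`n + 1` vertices indexed by `Fin (n+1)`, covering all `n ≥ 1` vertex quivers) is a
direct sum of thin representations: there are bases `B i` of the `V i` such that
each `f i` sends every element of `B i.castSucc` either to `0` or to an element of
`B i.succ`, injectively on those not sent to `0`. -/
theorem linear_An_rep_direct_sum_of_thin
    (K : Type*) [Field K] (n : ℕ)
    (V : Fin (n + 1) → Type*) [∀ i, AddCommGroup (V i)] [∀ i, Module K (V i)]
    (f : ∀ i : Fin n, V i.castSucc →ₗ[K] V i.succ) :
    ∃ B : ∀ i, Set (V i),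
      (∀ i, LinearIndependent K ((↑) : B i → V i) ∧ Submodule.span K (B i) = ⊤) ∧
      (∀ i : Fin n,
        (∀ b ∈ B i.castSucc, f i b = 0 ∨ f i b ∈ B i.succ) ∧
        Set.InjOn (f i) {b ∈ B i.castSucc | f i b ≠ 0}) := by
  obtain ⟨B, hB, hf, -⟩ := exists_adapted_bases_linear_An_rep n V f
    (W := fun _ ↦ ⊤) monotone_const (k := 0) rfl
  exact ⟨B, hB, hf⟩
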